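/- Let ω ∈ ℂ with ω² + ω + 1 = 0, and let c be a nonempty list of integers with every entry ≥ 2. Then r(c) ≡ s(c) (mod 3) if and only if 𝓡(c)(ω) = 𝓢(c)(ω). -/

import Mathlib

open Polynomial

/-- The `q`-deformation `[n]_q = 1 + q + ⋯ + q^{n-1}` of a nonnegative integer. -/
noncomputable def qNat (n : ℕ) : Polynomial ℤ := (Finset.range n).sum fun i => X ^ i

/-- The matrix `M_q⁻(c) = (([c]_q, -q^{c-1}), (1, 0))` over `ℤ[q]`. -/
noncomputable def MqNeg (c : ℕ) : Matrix (Fin 2) (Fin 2) (Polynomial ℤ) :=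
  !![qNat c, -(X ^ (c - 1)); 1, 0]

/-- `𝓡(c)`: the (0,0) entry of `M_q⁻(c₁)⋯M_q⁻(c_l)`. -/
noncomputable def Rpoly (L : List ℕ) : Polynomial ℤ := ((L.map MqNeg).prod) 0 0

/-- `𝓢(c)`: the (1,0) entry of `M_q⁻(c₁)⋯M_q⁻(c_l)`. -/
noncomputable def Spoly (L : List ℕ) : Polynomial ℤ := ((L.map MqNeg).prod) 1 0

/-- `r(c) = 𝓡(c)(1)`. -/
noncomputable def rNum (L : List ℕ) : ℤ := (Rpoly L).eval 1

/-- `s(c) = 𝓢(c)(1)`. -/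
noncomputable def sNum (L : List ℕ) : ℤ := (Spoly L).eval 1

lemma Rpoly_cons (c : ℕ) (L : List ℕ) :
    Rpoly (c :: L) = qNat c * Rpoly L - X ^ (c - 1) * Spoly L := by
  simp [Rpoly, Spoly, MqNeg, Matrix.mul_apply, Fin.sum_univ_two, sub_eq_add_neg]

lemma Spoly_cons (c : ℕ) (L : List ℕ) : Spoly (c :: L) = Rpoly L := by
  simp [Rpoly, Spoly, MqNeg, Matrix.mul_apply, Fin.sum_univ_two]

lemma rNum_cons (c : ℕ) (L : List ℕ) : rNum (c :: L) = c * rNum L - sNum L := by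
  simp [rNum, sNum, Rpoly_cons, qNat, eval_finsetSum]

lemma sNum_cons (c : ℕ) (L : List ℕ) : sNum (c :: L) = rNum L := by
  simp [rNum, sNum, Spoly_cons]

lemma aeval_qNat_three_mul_add (ω : ℂ) (hω : ω ^ 2 + ω + 1 = 0) (k j : ℕ) :
    aeval ω (qNat (3 * k + j)) = aeval ω (qNat j) := by
  induction k with
  | zero => simp
  | succ k ih =>
    rw [← ih, show 3 * (k + 1) + j = 3 * k + j + 1 + 1 + 1 by ring]
    simp only [qNat, Finset.sum_range_succ, map_add, map_pow, aeval_X]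
    linear_combination ω ^ (3 * k + j) * hω

/-- The points `(r : s)` of the projective line over `𝔽₃` correspond to the points
`0`, `∞`, `1`, `-ω²` of the complex projective line; the relation says that
`(r : s)` and `(x : y)` correspond. -/
def CubeRootCompatible (ω x y : ℂ) (r s : ℤ) : Prop :=
  (r % 3 ≠ 0 ∧ s % 3 = 0 ∧ x ≠ 0 ∧ y = 0) ∨
  (r % 3 = 0 ∧ s % 3 ≠ 0 ∧ x = 0 ∧ y ≠ 0) ∨
  (r % 3 = s % 3 ∧ s % 3 ≠ 0 ∧ x = y ∧ y ≠ 0) ∨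
  ((r + s) % 3 = 0 ∧ s % 3 ≠ 0 ∧ x = -ω ^ 2 * y ∧ y ≠ 0)

lemma CubeRootCompatible.step {ω x y : ℂ} {r s : ℤ} (hω : ω ^ 2 + ω + 1 = 0)
    (h : CubeRootCompatible ω x y r s) {c : ℕ} (hc : 1 ≤ c) :
    CubeRootCompatible ω (aeval ω (qNat c) * x - ω ^ (c - 1) * y) x (c * r - s) r := by
  have h3 : ω ^ 3 = 1 := by linear_combination (ω - 1) * hω
  have h0 : ω ≠ 0 := by rintro rfl; simp at hω
  obtain ⟨k, hk⟩ : ∃ k, c = 3 * k + 1 ∨ c = 3 * k + 2 ∨ c = 3 * k + 3 :=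
    ⟨(c - 1) / 3, by omega⟩
  unfold CubeRootCompatible at *
  rcases hk with rfl | rfl | rfl
  · have hb : ω ^ (3 * k + 1 - 1) = 1 := by simp [pow_mul, h3]
    rw [aeval_qNat_three_mul_add ω hω, hb]
    have ha : aeval ω (qNat 1) = 1 := by simp [qNat]
    rw [ha]
    have hr : ((3 * k + 1 : ℕ) : ℤ) * r - s = 3 * (k * r) + (r - s) := by push_cast; ring
    rw [hr]
    generalize (k : ℤ) * r = m
    rcases h with ⟨_, _, hx, rfl⟩ | ⟨_, _, rfl, hy⟩ | ⟨_, _, rfl, hy⟩ | ⟨_, _, rfl, hy⟩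
    · exact Or.inr (Or.inr (Or.inl ⟨by omega, by omega, by ring, hx⟩))
    · exact Or.inl ⟨by omega, by omega, by simpa using hy, rfl⟩
    · exact Or.inr (Or.inl ⟨by omega, by omega, by ring, hy⟩)
    · refine Or.inr (Or.inr (Or.inr ⟨by omega, by omega, ?_, by simp [h0, hy]⟩))
      linear_combination -y * hω - y * ω * h3
  · have hb : ω ^ (3 * k + 2 - 1) = ω := by
      rw [show 3 * k + 2 - 1 = 3 * k + 1 by omega]; simp [pow_succ, pow_mul, h3]
    rw [aeval_qNat_three_mul_add ω hω, hb]
    have ha : aeval ω (qNat 2) = -ω ^ 2 := by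
      simp only [qNat, Finset.sum_range_succ, Finset.sum_range_zero, map_add, map_pow, aeval_X,
        map_zero]
      linear_combination hω
    rw [ha]
    have hr : ((3 * k + 2 : ℕ) : ℤ) * r - s = 3 * (k * r) + (2 * r - s) := by push_cast; ring
    rw [hr]
    generalize (k : ℤ) * r = m
    rcases h with ⟨_, _, hx, rfl⟩ | ⟨_, _, rfl, hy⟩ | ⟨_, _, rfl, hy⟩ | ⟨_, _, rfl, hy⟩
    · exact Or.inr (Or.inr (Or.inr ⟨by omega, by omega, by ring, hx⟩))
    · exact Or.inl ⟨by omega, by omega, by simp [h0, hy], rfl⟩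
    · refine Or.inr (Or.inr (Or.inl ⟨by omega, by omega, ?_, hy⟩))
      linear_combination -x * hω
    · refine Or.inr (Or.inl ⟨by omega, by omega, ?_, by simp [h0, hy]⟩)
      linear_combination y * ω * h3
  · have hb : ω ^ (3 * k + 3 - 1) = ω ^ 2 := by
      rw [show 3 * k + 3 - 1 = 3 * k + 2 by omega]; simp [pow_add, pow_mul, h3]
    rw [aeval_qNat_three_mul_add ω hω, hb]
    have ha : aeval ω (qNat 3) = 0 := by
      simp only [qNat, Finset.sum_range_succ, Finset.sum_range_zero, map_add, map_pow, aeval_X,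
        map_zero]
      linear_combination hω
    rw [ha]
    have hr : ((3 * k + 3 : ℕ) : ℤ) * r - s = 3 * (k * r + r) + (-s) := by push_cast; ring
    rw [hr]
    generalize (k : ℤ) * r + r = m
    rcases h with ⟨_, _, hx, rfl⟩ | ⟨_, _, rfl, hy⟩ | ⟨_, _, rfl, hy⟩ | ⟨_, _, rfl, hy⟩
    · exact Or.inr (Or.inl ⟨by omega, by omega, by ring, hx⟩)
    · exact Or.inl ⟨by omega, by omega, by simp [h0, hy], rfl⟩
    · exact Or.inr (Or.inr (Or.inr ⟨by omega, by omega, by ring, hy⟩))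
    · exact Or.inr (Or.inr (Or.inl ⟨by omega, by omega, by ring, by simp [h0, hy]⟩))

lemma cubeRootCompatible_Rpoly_Spoly {ω : ℂ} (hω : ω ^ 2 + ω + 1 = 0) (L : List ℕ)
    (hL : ∀ y ∈ L, 1 ≤ y) :
    CubeRootCompatible ω (aeval ω (Rpoly L)) (aeval ω (Spoly L)) (rNum L) (sNum L) := by
  induction L with
  | nil => left; simp [rNum, sNum, Rpoly, Spoly]
  | cons c L ih =>
    have h := (ih fun y hy => hL y (List.mem_cons_of_mem _ hy)).step hω (hL c List.mem_cons_self)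
    simpa [Rpoly_cons, Spoly_cons, rNum_cons, sNum_cons] using h

lemma CubeRootCompatible.modEq_iff {ω x y : ℂ} {r s : ℤ} (hω : ω ^ 2 + ω + 1 = 0)
    (h : CubeRootCompatible ω x y r s) : r ≡ s [ZMOD 3] ↔ x = y := by
  unfold Int.ModEq
  rcases h with ⟨_, _, hx, rfl⟩ | ⟨_, _, rfl, hy⟩ | ⟨_, _, rfl, hy⟩ | ⟨_, _, rfl, hy⟩
  · exact iff_of_false (by omega) hx
  · exact iff_of_false (by omega) hy.symm
  · exact iff_of_true (by omega) rfl
  · refine iff_of_false (by omega) fun h => ?_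
    have hsq : ω ^ 2 = -1 := mul_right_cancel₀ hy (by linear_combination -h)
    have h0 : ω = 0 := by linear_combination hω - hsq
    simp [h0] at hω

/-- For a primitive cube root of unity `ω` and a negative continued-fraction list `L`:
`r(L) ≡ s(L) (mod 3)` if and only if `𝓡(L)(ω) = 𝓢(L)(ω)`. -/
theorem stmt14 (ω : ℂ) (hω : ω ^ 2 + ω + 1 = 0)
    (L : List ℕ) (hL : L ≠ []) (hL2 : ∀ y ∈ L, 2 ≤ y) :
    rNum L ≡ sNum L [ZMOD 3] ↔
      (Polynomial.aeval ω) (Rpoly L) = (Polynomial.aeval ω) (Spoly L) := by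
  exact (cubeRootCompatible_Rpoly_Spoly hω L fun y hy => one_le_two.trans (hL2 y hy)).modEq_iff hω
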